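/- For every integer m ≥ 1, the limit lim_{k→∞} log(|G_{m,k}|)/ℓ_{m,k} exists and equals ((λ_m − 1)/(1 − λ'_m)) · Σ_{i=2}^{∞} log(m(i−1)+1)/λ_m^i, where |G_{m,k}| denotes the cardinality of the finite set G_{m,k}. -/

import Mathlib

inductive Letter : Type
  | a : Letter
  | b : Letter
deriving DecidableEq

/-- The sets `G m k` of exact substitution words of the random noble means
substitution. -/
def G (m : ℕ) : ℕ → Set (List Letter)
  | 0 => ∅
  | 1 => {[Letter.b]}
  | 2 => {[Letter.a]}
  | (k + 3) =>
      ⋃ i ∈ Finset.range (m + 1),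
        { w | ∃ f : Fin (m + 1) → List Letter,
            (∀ j : Fin (m + 1),
              f j ∈ if (j : ℕ) = i then G m (k + 1) else G m (k + 2)) ∧
            w = (List.ofFn f).flatten }

/-- The lengths `ℓ_{m,k}`. -/
def ell (m : ℕ) : ℕ → ℕ
  | 0 => 0
  | 1 => 1
  | 2 => 1
  | (k + 3) => m * ell m (k + 2) + ell m (k + 1)

namespace Language

variable {α : Type*}

/-- Concatenations of `p` words of `A` and one word of `B`, the latter in any position. -/
def insertOne (A B : Language α) : ℕ → Language α
  | 0 => B
  | p + 1 => A * insertOne A B p + B * A ^ (p + 1)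

theorem mul_pow_le_insertOne (A B : Language α) (p : ℕ) : B * A ^ p ≤ insertOne A B p := by
  cases p with
  | zero => simp [insertOne]
  | succ p => exact fun w hw => Or.inr hw

theorem mul_insertOne_le (A B : Language α) (p : ℕ) :
    A * insertOne A B p ≤ insertOne A B (p + 1) :=
  fun _ hw => Or.inl hw

theorem insertOne_succ' (A B : Language α) (p : ℕ) :
    insertOne A B (p + 1) = insertOne A B p * A + A ^ (p + 1) * B := by
  induction p with
  | zero => simp [insertOne, add_comm]
  | succ p ih =>
    conv_lhs => rw [insertOne, ih]
    conv_rhs => rw [insertOne]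
    nth_rewrite 1 [pow_succ A (p + 1)]
    simp only [mul_add, add_mul, pow_succ' A (p + 1), mul_assoc]
    abel

theorem insertOne_mul_le (A B : Language α) (p : ℕ) :
    insertOne A B p * A ≤ insertOne A B (p + 1) := by
  rw [insertOne_succ']
  exact fun w hw => Or.inl hw

/-- All words of the language have length `n`. -/
def Homogeneous (L : Language α) (n : ℕ) : Prop := ∀ w ∈ L, w.length = n

theorem Homogeneous.mul {L M : Language α} {k n : ℕ} (hL : L.Homogeneous k)
    (hM : M.Homogeneous n) : (L * M).Homogeneous (k + n) := by
  rintro w hw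
  obtain ⟨x, hx, y, hy, rfl⟩ := mem_mul.1 hw
  rw [List.length_append, hL x hx, hM y hy]

theorem Homogeneous.pow {L : Language α} {k : ℕ} (hL : L.Homogeneous k) (p : ℕ) :
    (L ^ p).Homogeneous (p * k) := by
  induction p with
  | zero => intro w hw; simp_all
  | succ p ih => rw [pow_succ, add_mul, one_mul]; exact ih.mul hL

theorem Homogeneous.insertOne {A B : Language α} {k n : ℕ} (hA : A.Homogeneous k)
    (hB : B.Homogeneous n) (p : ℕ) : (insertOne A B p).Homogeneous (p * k + n) := by
  induction p with
  | zero => simpa [Language.insertOne] using hB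
  | succ p ih =>
    rintro w (hw | hw)
    · rw [(hA.mul ih) w hw]; ring
    · rw [(hB.mul (hA.pow (p + 1))) w hw]; ring

theorem Homogeneous.finite [Finite α] {L : Language α} {n : ℕ} (hL : L.Homogeneous n) :
    Set.Finite (α := List α) L :=
  (List.finite_length_eq α n).subset hL

/-- Removing a prefix in `A` from a word of `insertOne A B (p + 1)` leaves a word of
`insertOne A B p`. -/
def PrefixRemovable (A B : Language α) : Prop :=
  ∀ p x w, x ∈ A → x ++ w ∈ insertOne A B (p + 1) → w ∈ insertOne A B p

/-- Removing a prefix in `insertOne A B p` from a word of `insertOne A B (p + 1)` leaves a word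
of `A`. -/
def InsertOneRemovable (A B : Language α) : Prop :=
  ∀ p x w, x ∈ insertOne A B p → x ++ w ∈ insertOne A B (p + 1) → w ∈ A

/-- If a word factors both in `B * A ^ q * univ` and in `A ^ (q + 1) * B`, then the last factor of
the first factorization lies in `A`. -/
def ShiftRemovable (A B : Language α) : Prop :=
  ∀ q b y r z c, b ∈ B → y ∈ A ^ q → z ∈ A ^ (q + 1) → c ∈ B → b ++ (y ++ r) = z ++ c → r ∈ A

theorem PrefixRemovable.insertOneRemovable {A B : Language α} {k n : ℕ} (hA : A.Homogeneous k)
    (hB : B.Homogeneous n) (hp : PrefixRemovable A B) (hs : ShiftRemovable A B) :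
    InsertOneRemovable A B := by
  have key (p : ℕ) (x w : List α) (hx : x ∈ B * A ^ p) (hxw : x ++ w ∈ insertOne A B (p + 1)) :
      w ∈ A := by
    rw [insertOne_succ'] at hxw
    rcases hxw with hxw | hxw
    · obtain ⟨u, hu, a, ha, h⟩ := mem_mul.1 hxw
      have hl : u.length = x.length := by
        rw [hA.insertOne hB p u hu, hB.mul (hA.pow p) x hx]; ring
      exact (List.append_inj h hl).2 ▸ ha
    · obtain ⟨z, hz, c, hc, h⟩ := mem_mul.1 hxw
      obtain ⟨b, hb, y, hy, rfl⟩ := mem_mul.1 hx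
      exact hs p b y w z c hb hy hz hc (by rw [h, List.append_assoc])
  intro p
  induction p with
  | zero => exact fun x w hx => key 0 x w (by simpa [insertOne] using hx)
  | succ p ih =>
    rintro x w (hx | hx) hxw
    · obtain ⟨a, ha, y, hy, rfl⟩ := mem_mul.1 hx
      exact ih y w hy (hp (p + 1) a (y ++ w) ha (by rwa [← List.append_assoc]))
    · exact key (p + 1) x w hx hxw

theorem exists_append_of_mem_insertOne {A B : Language α} {k n m : ℕ} (hA : A.Homogeneous k)
    (hB : B.Homogeneous n) (hp : PrefixRemovable A B) {x a u v : List α}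
    (hx : x ∈ insertOne A B (m + 1)) (ha : a ∈ A) (h : x ++ u = a ++ v) :
    ∃ d ∈ insertOne A B m, x = a ++ d ∧ v = d ++ u := by
  have hl : a.length ≤ x.length := by
    rw [hA a ha, hA.insertOne hB _ x hx]; nlinarith
  obtain ⟨d, rfl⟩ : a <+: x :=
    List.prefix_of_prefix_length_le (List.prefix_append a v) (h ▸ List.prefix_append x u) hl
  exact ⟨d, hp m a d ha hx, rfl, by simpa using h.symm⟩

theorem exists_append_of_insertOne_append {A B : Language α} {k n m : ℕ}
    (hA : A.Homogeneous k) (hB : B.Homogeneous n) (hi : InsertOneRemovable A B)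
    {x d u v : List α} (hx : x ∈ insertOne A B (m + 1)) (hd : d ∈ insertOne A B m)
    (h : x ++ u = d ++ v) : ∃ e ∈ A, x = d ++ e ∧ v = e ++ u := by
  have hl : d.length ≤ x.length := by
    rw [hA.insertOne hB _ d hd, hA.insertOne hB _ x hx]; nlinarith
  obtain ⟨e, rfl⟩ : d <+: x :=
    List.prefix_of_prefix_length_le (List.prefix_append d v) (h ▸ List.prefix_append x u) hl
  exact ⟨e, hi m d e hd hx, rfl, by simpa using h.symm⟩

theorem PrefixRemovable.step {A B : Language α} {k n m : ℕ} (hA : A.Homogeneous k)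
    (hB : B.Homogeneous n) (hp : PrefixRemovable A B) (hi : InsertOneRemovable A B) :
    PrefixRemovable (insertOne A B (m + 1)) A := by
  rintro p x w hx (hxw | hxw)
  · obtain ⟨y, hy, v, hv, h⟩ := mem_mul.1 hxw
    have hl : y.length = x.length := by
      rw [hA.insertOne hB _ x hx, hA.insertOne hB _ y hy]
    exact (List.append_inj h hl).2 ▸ hv
  · obtain ⟨a, ha, v, hv, h⟩ := mem_mul.1 hxw
    rw [pow_succ'] at hv
    obtain ⟨y, hy, z, hz, rfl⟩ := mem_mul.1 hv
    obtain ⟨d, hd, rfl, h'⟩ := exists_append_of_mem_insertOne hA hB hp hx ha h.symm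
    obtain ⟨e, he, rfl, rfl⟩ := exists_append_of_insertOne_append hA hB hi hy hd h'
    exact mul_pow_le_insertOne _ _ p (append_mem_mul he hz)

theorem ShiftRemovable.step {A B : Language α} {k n m : ℕ} (hA : A.Homogeneous k)
    (hB : B.Homogeneous n) (hp : PrefixRemovable A B) (hi : InsertOneRemovable A B) :
    ShiftRemovable (insertOne A B (m + 1)) A := by
  intro q
  induction q with
  | zero =>
    intro b y r z c hb hy hz hc h
    rw [pow_zero, mem_one] at hy
    rw [zero_add, pow_one] at hz
    subst hy
    obtain ⟨d, hd, rfl, h'⟩ := exists_append_of_mem_insertOne hA hB hp hz hb h.symm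
    rw [List.nil_append] at h'
    exact h' ▸ insertOne_mul_le A B m (append_mem_mul hd hc)
  | succ q ih =>
    intro b y r z c hb hy hz hc h
    rw [pow_succ'] at hy hz
    obtain ⟨y₁, hy₁, y₂, hy₂, rfl⟩ := mem_mul.1 hy
    obtain ⟨z₁, hz₁, z₂, hz₂, rfl⟩ := mem_mul.1 hz
    simp only [List.append_assoc] at h
    obtain ⟨d, hd, rfl, h'⟩ := exists_append_of_mem_insertOne hA hB hp hz₁ hb h.symm
    obtain ⟨e, he, rfl, h''⟩ := exists_append_of_insertOne_append hA hB hi hy₁ hd h'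
    exact ih e y₂ r z₂ c he hy₂ hz₂ hc h''.symm

theorem mul_inf_mul_insertOne {A B : Language α} {k n m : ℕ} (hA : A.Homogeneous k)
    (hB : B.Homogeneous n) (hp : PrefixRemovable A B) :
    A * insertOne A B (m + 1) ⊓ insertOne A B (m + 1) * A = A * (insertOne A B m * A) := by
  apply le_antisymm
  · rintro w ⟨hw, hw'⟩
    obtain ⟨a, ha, y, hy, rfl⟩ := mem_mul.1 hw
    obtain ⟨x, hx, c, hc, h⟩ := mem_mul.1 hw'
    obtain ⟨d, hd, rfl, rfl⟩ := exists_append_of_mem_insertOne hA hB hp hx ha h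
    exact append_mem_mul ha (append_mem_mul hd hc)
  · apply le_inf
    · exact mul_le_mul_right (insertOne_mul_le A B m) A
    · rw [← mul_assoc]
      exact mul_le_mul_left (mul_insertOne_le A B m) A

theorem mul_insertOne_inf {A B : Language α} {k n : ℕ} (hA : A.Homogeneous k)
    (hB : B.Homogeneous n) (hp : PrefixRemovable A B) (p : ℕ) :
    A * insertOne A B p ⊓ B * A ^ (p + 1) = (B * A ⊓ A * B) * A ^ p := by
  apply le_antisymm
  · rintro w ⟨hw, hw'⟩
    obtain ⟨x, hx, v, hv, h⟩ := mem_mul.1 hw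
    rw [pow_succ', ← mul_assoc] at hw'
    obtain ⟨u, hu, z, hz, rfl⟩ := mem_mul.1 hw'
    refine append_mem_mul ⟨hu, ?_⟩ hz
    have hl : x.length ≤ u.length := by
      rw [hA x hx, hB.mul hA u hu]; omega
    obtain ⟨d, rfl⟩ : x <+: u :=
      List.prefix_of_prefix_length_le (h ▸ List.prefix_append x v) (List.prefix_append u z) hl
    refine append_mem_mul hx (hp 0 x d hx (mul_pow_le_insertOne A B 1 ?_))
    rwa [pow_one]
  · intro w hw
    obtain ⟨u, ⟨hu, hu'⟩, z, hz, rfl⟩ := mem_mul.1 hw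
    constructor
    · obtain ⟨x, hx, c, hc, rfl⟩ := mem_mul.1 hu'
      rw [List.append_assoc]
      exact append_mem_mul hx (mul_pow_le_insertOne A B p (append_mem_mul hc hz))
    · show u ++ z ∈ B * A ^ (p + 1)
      rw [pow_succ', ← mul_assoc]
      exact append_mem_mul hu hz

/-- The number of words of a language (zero if infinite). -/
noncomputable def card (L : Language α) : ℕ := Set.ncard (α := List α) L

theorem card_add_card_inf [Finite α] {L M : Language α} {k n : ℕ} (hL : L.Homogeneous k)
    (hM : M.Homogeneous n) : (L + M).card + (L ⊓ M).card = L.card + M.card :=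
  Set.ncard_union_add_ncard_inter _ _ hL.finite hM.finite

theorem Homogeneous.card_mul {L : Language α} {k : ℕ} (hL : L.Homogeneous k) (M : Language α) :
    (L * M).card = L.card * M.card := by
  have h : Set.InjOn (fun p : List α × List α => p.1 ++ p.2)
      (SProd.sprod (α := Set (List α)) (β := Set (List α)) L M) := by
    rintro ⟨x, y⟩ ⟨hx, -⟩ ⟨x', y'⟩ ⟨hx', -⟩ h
    obtain ⟨rfl, rfl⟩ := List.append_inj h ((hL x hx).trans (hL x' hx').symm)
    rfl
  exact (congrArg Set.ncard (Set.image_prod _)).symm.trans (h.ncard_image.trans Set.ncard_prod)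

theorem Homogeneous.card_pow {L : Language α} {k : ℕ} (hL : L.Homogeneous k) (p : ℕ) :
    (L ^ p).card = L.card ^ p := by
  induction p with
  | zero => simp only [pow_zero]; exact Set.ncard_singleton _
  | succ p ih => rw [pow_succ', pow_succ', hL.card_mul, ih]

theorem card_insertOne_succ [Finite α] {A B : Language α} {k n : ℕ} (hA : A.Homogeneous k)
    (hB : B.Homogeneous n) (hp : PrefixRemovable A B) (p : ℕ) :
    (insertOne A B (p + 1)).card + (B * A ⊓ A * B).card * A.card ^ p =
      A.card * (insertOne A B p).card + B.card * A.card ^ (p + 1) := by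
  have hI : (B * A ⊓ A * B).Homogeneous (n + k) := fun w hw => hB.mul hA w hw.1
  have := card_add_card_inf (hA.mul (hA.insertOne hB p)) (hB.mul (hA.pow (p + 1)))
  rwa [mul_insertOne_inf hA hB hp, hI.card_mul, hA.card_mul, hB.card_mul, hA.card_pow,
    hA.card_pow] at this

theorem card_insertOne_mul [Finite α] {A B : Language α} {k n : ℕ} (hA : A.Homogeneous k)
    (hB : B.Homogeneous n) (hp : PrefixRemovable A B) {s t : ℝ}
    (hc : ((B * A ⊓ A * B).card : ℝ) * t = s * (A.card * B.card)) (p : ℕ) :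
    ((insertOne A B p).card : ℝ) * t = A.card ^ p * B.card * ((p + 1) * t - p * s) := by
  induction p with
  | zero => simp [insertOne]
  | succ p ih =>
    have h : ((insertOne A B (p + 1)).card : ℝ) + (B * A ⊓ A * B).card * A.card ^ p =
      A.card * (insertOne A B p).card + B.card * A.card ^ (p + 1) := by
      exact_mod_cast card_insertOne_succ hA hB hp p
    push_cast
    linear_combination t * h + A.card * ih - A.card ^ p * hc

end Language

open Language in
theorem mem_insertOne_iff {α : Type*} (A B : Language α) (p : ℕ) (w : List α) :
    w ∈ insertOne A B p ↔ ∃ i < p + 1, ∃ f : Fin (p + 1) → List α,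
      (∀ j : Fin (p + 1), f j ∈ if (j : ℕ) = i then B else A) ∧ w = (List.ofFn f).flatten := by
  have pow_iff (q : ℕ) (v : List α) : v ∈ A ^ q ↔
      ∃ f : Fin q → List α, (∀ j, f j ∈ A) ∧ v = (List.ofFn f).flatten := by
    rw [mem_pow]
    constructor
    · rintro ⟨S, rfl, rfl, hS⟩
      exact ⟨S.get, fun j => hS _ (List.get_mem S j), by rw [List.ofFn_get]⟩
    · rintro ⟨f, hf, rfl⟩
      exact ⟨List.ofFn f, rfl, List.length_ofFn, by simpa [List.mem_ofFn] using hf⟩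
  induction p generalizing w with
  | zero =>
    constructor
    · exact fun hw => ⟨0, by simp, fun _ => w, fun j => by simpa [Fin.eq_zero j, insertOne] using hw,
        by simp⟩
    · rintro ⟨i, hi, f, hf, rfl⟩
      obtain rfl : i = 0 := by omega
      simpa [insertOne] using hf 0
  | succ p ih =>
    constructor
    · rintro (hw | hw)
      · obtain ⟨a, ha, v, hv, rfl⟩ := mem_mul.1 hw
        obtain ⟨i, hi, f, hf, rfl⟩ := (ih v).1 hv
        refine ⟨i + 1, by omega, Fin.cons a f, fun j => ?_, by simp [List.ofFn_succ]⟩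
        cases j using Fin.cases with
        | zero => simpa using ha
        | succ j => simpa using hf j
      · obtain ⟨b, hb, v, hv, rfl⟩ := mem_mul.1 hw
        obtain ⟨f, hf, rfl⟩ := (pow_iff _ v).1 hv
        refine ⟨0, by omega, Fin.cons b f, fun j => ?_, by simp [List.ofFn_succ]⟩
        cases j using Fin.cases with
        | zero => simpa using hb
        | succ j => simpa using hf j
    · rintro ⟨i, hi, f, hf, rfl⟩
      rw [List.ofFn_succ, List.flatten_cons]
      cases i with
      | zero =>
        refine Or.inr (append_mem_mul (by simpa using hf 0) ((pow_iff _ _).2 ⟨_, fun j => ?_, rfl⟩))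
        simpa using hf j.succ
      | succ i =>
        refine Or.inl (append_mem_mul (by simpa using hf 0)
          ((ih _).2 ⟨i, by omega, _, fun j => ?_, rfl⟩))
        simpa using hf j.succ

/-- The set `G m (k + 1)` as a language. -/
def substLanguage (m k : ℕ) : Language Letter := G m (k + 1)

theorem substLanguage_add_two (m k : ℕ) :
    substLanguage m (k + 2) =
      Language.insertOne (substLanguage m (k + 1)) (substLanguage m k) m := by
  ext w
  rw [mem_insertOne_iff]
  change w ∈ G m (k + 3) ↔ _
  simp only [G, Set.mem_iUnion, Finset.mem_range, exists_prop, Set.mem_ofPred_eq]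
  refine exists_congr fun i => and_congr_right fun _ => exists_congr fun f =>
    and_congr_left fun _ => forall_congr' fun j => ?_
  split_ifs <;> rfl

theorem homogeneous_substLanguage (m : ℕ) (k : ℕ) :
    (substLanguage m k).Homogeneous (ell m (k + 1)) := by
  induction k using Nat.twoStepInduction with
  | zero => rintro w rfl; rfl
  | one => rintro w rfl; rfl
  | more k ih₀ ih₁ => rw [substLanguage_add_two]; exact ih₁.insertOne ih₀ m

open Language in
theorem removable_substLanguage {m : ℕ} (hm : 1 ≤ m) (k : ℕ) :
    PrefixRemovable (substLanguage m (k + 1)) (substLanguage m k) ∧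
      ShiftRemovable (substLanguage m (k + 1)) (substLanguage m k) := by
  obtain ⟨m, rfl⟩ := Nat.exists_eq_add_of_le' hm
  induction k with
  | zero =>
    constructor
    · rintro p x w rfl (hw | hw)
      · obtain ⟨y, rfl, v, hv, h⟩ := mem_mul.1 hw
        exact (List.append_inj h rfl).2 ▸ hv
      · obtain ⟨y, rfl, v, hv, h⟩ := mem_mul.1 hw
        simp at h
    · rintro q b y r z c rfl hy hz hc h
      rw [pow_succ'] at hz
      obtain ⟨x, rfl, v, hv, rfl⟩ := mem_mul.1 hz
      simp at h
  | succ k ih =>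
    have hA := homogeneous_substLanguage (m + 1) (k + 1)
    have hB := homogeneous_substLanguage (m + 1) k
    have hi := ih.1.insertOneRemovable hA hB ih.2
    rw [substLanguage_add_two]
    exact ⟨ih.1.step hA hB hi, ShiftRemovable.step hA hB ih.1 hi⟩

instance : Finite Letter :=
  Finite.of_injective (fun l : Letter => decide (l = Letter.a)) fun x y => by
    cases x <;> cases y <;> simp

open Language in
theorem card_inf_substLanguage {m : ℕ} (hm : 1 ≤ m) (k : ℕ) :
    ((substLanguage m k * substLanguage m (k + 1) ⊓
        substLanguage m (k + 1) * substLanguage m k).card : ℝ) * (m * k + 1) =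
      m * k * ((substLanguage m (k + 1)).card * (substLanguage m k).card) := by
  obtain ⟨m, rfl⟩ := Nat.exists_eq_add_of_le' hm
  induction k with
  | zero =>
    have : substLanguage (m + 1) 0 * substLanguage (m + 1) 1 ⊓
        substLanguage (m + 1) 1 * substLanguage (m + 1) 0 = 0 := by
      ext w
      refine ⟨?_, fun h => h.elim⟩
      rintro ⟨h, h'⟩
      obtain ⟨x, rfl, y, rfl, rfl⟩ := mem_mul.1 h
      obtain ⟨x, rfl, y, rfl, h⟩ := mem_mul.1 h'
      simp at h
    have h₀ : (0 : Language Letter).card = 0 := Set.ncard_empty _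
    simp [this, h₀]
  | succ k ih =>
    have hA := homogeneous_substLanguage (m + 1) (k + 1)
    have hB := homogeneous_substLanguage (m + 1) k
    have hp := (removable_substLanguage hm k).1
    have h₁ := card_insertOne_mul hA hB hp ih m
    have h₂ := card_insertOne_mul hA hB hp ih (m + 1)
    rw [substLanguage_add_two, mul_inf_mul_insertOne hA hB hp, hA.card_mul,
      (hA.insertOne hB m).card_mul]
    have ht : (((m + 1 : ℕ) : ℝ) * k + 1) ≠ 0 := by positivity
    apply mul_right_cancel₀ ht
    push_cast at h₁ h₂ ⊢
    linear_combination (substLanguage (m + 1) (k + 1)).card ^ 2 * ((m + 1) * (k + 1) + 1) * h₁ -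
      (m + 1) * (k + 1) * (substLanguage (m + 1) (k + 1)).card * h₂

open Language in
theorem card_substLanguage_add_two {m : ℕ} (hm : 1 ≤ m) (k : ℕ) :
    ((substLanguage m (k + 2)).card : ℝ) * (m * k + 1) =
      (substLanguage m (k + 1)).card ^ m * (substLanguage m k).card * (m * (k + 1) + 1) := by
  rw [substLanguage_add_two, card_insertOne_mul (homogeneous_substLanguage m (k + 1))
    (homogeneous_substLanguage m k) (removable_substLanguage hm k).1
    (card_inf_substLanguage hm k) m]
  ring

theorem card_substLanguage_pos {m : ℕ} (hm : 1 ≤ m) (k : ℕ) :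
    (0 : ℝ) < (substLanguage m k).card := by
  induction k using Nat.twoStepInduction with
  | zero => simp [Language.card, substLanguage, G]
  | one => simp [Language.card, substLanguage, G]
  | more k ih₀ ih₁ =>
    have h := card_substLanguage_add_two hm k
    have : (0 : ℝ) < (substLanguage m (k + 2)).card * (m * k + 1) := by rw [h]; positivity
    exact pos_of_mul_pos_left this (by positivity)

theorem log_card_substLanguage_add_two {m : ℕ} (hm : 1 ≤ m) (k : ℕ) :
    Real.log (substLanguage m (k + 2)).card =
      m * Real.log (substLanguage m (k + 1)).card + Real.log (substLanguage m k).card +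
        (Real.log (m * (k + 1 : ℕ) + 1) - Real.log (m * k + 1)) := by
  have h := congrArg Real.log (card_substLanguage_add_two hm k)
  have h₀ := card_substLanguage_pos hm k
  have h₁ := card_substLanguage_pos hm (k + 1)
  have h₂ := card_substLanguage_pos hm (k + 2)
  rw [Real.log_mul h₂.ne' (by positivity), Real.log_mul (by positivity) (by positivity),
    Real.log_mul (by positivity) h₀.ne', Real.log_pow] at h
  push_cast
  linarith

open Filter Topology

/-- Normalised limit of a solution of an inhomogeneous linear recurrence whose characteristic roots
are `r` and `r'`, with bounded inhomogeneity. -/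
theorem tendsto_div_pow_of_linear_recurrence {r r' K c : ℝ} {x s : ℕ → ℝ} (hr : 1 < r)
    (hr' : |r'| < 1)
    (hx : ∀ k, x (k + 2) = (r + r') * x (k + 1) - r * r' * x k + s k)
    (hs : ∀ k, |s k| ≤ K) (hc : HasSum (fun k => s k / r ^ (k + 1)) c) :
    Tendsto (fun k => x k / r ^ k) atTop (𝓝 ((x 1 - r' * x 0 + c) / (r - r'))) := by
  have hr0 : 0 < r := by linarith
  have hrr : r - r' ≠ 0 := by linarith [le_abs_self r']
  have hD (k : ℕ) : (x (k + 1) - r' * x k) / r ^ k =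
      x 1 - r' * x 0 + ∑ i ∈ Finset.range k, s i / r ^ (i + 1) := by
    induction k with
    | zero => simp
    | succ k ih =>
      rw [Finset.sum_range_succ, ← add_assoc, ← ih, hx]
      field_simp
      ring
  obtain ⟨M, hM⟩ : ∃ M, ∀ k, |x (k + 1) - r * x k| ≤ M := by
    refine ⟨max |x 1 - r * x 0| (K / (1 - |r'|)), fun k => ?_⟩
    induction k with
    | zero => exact le_max_left _ _
    | succ k ih =>
      set M := max |x 1 - r * x 0| (K / (1 - |r'|))
      have hK : K ≤ M * (1 - |r'|) := (div_le_iff₀ (by linarith)).1 (le_max_right _ _)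
      calc |x (k + 1 + 1) - r * x (k + 1)| = |r' * (x (k + 1) - r * x k) + s k| := by
            rw [hx]; ring_nf
        _ ≤ |r'| * |x (k + 1) - r * x k| + |s k| := by
            rw [← abs_mul]; exact abs_add_le _ _
        _ ≤ |r'| * M + K := by gcongr; exact hs k
        _ ≤ M := by linarith
  have hF : Tendsto (fun k => (x (k + 1) - r * x k) / r ^ k) atTop (𝓝 0) := by
    have h0 : Tendsto (fun k : ℕ => M * (r⁻¹) ^ k) atTop (𝓝 0) := by
      simpa using (tendsto_pow_atTop_nhds_zero_of_lt_one (by positivity)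
        (inv_lt_one_of_one_lt₀ hr)).const_mul M
    refine squeeze_zero_norm (fun k => ?_) h0
    rw [Real.norm_eq_abs, abs_div, abs_of_pos (pow_pos hr0 k), inv_pow, ← div_eq_mul_inv]
    gcongr
    exact hM k
  have h := (((hc.tendsto_sum_nat.const_add (x 1 - r' * x 0)).sub hF).div_const (r - r'))
  rw [sub_zero] at h
  refine h.congr fun k => ?_
  rw [← hD]
  field_simp
  ring

/-- Summation by parts for geometrically weighted sums. -/
theorem hasSum_sub_div_pow {r : ℝ} (hr : r ≠ 0) {t : ℕ → ℝ} (ht₀ : t 0 = 0)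
    (ht : Summable fun k => t k / r ^ k) :
    HasSum (fun k => (t (k + 1) - t k) / r ^ (k + 1))
      ((r - 1) * ∑' k, t (k + 1) / r ^ (k + 2)) := by
  have h₁ : HasSum (fun k => t (k + 1) / r ^ (k + 1)) (∑' k, t (k + 1) / r ^ (k + 1)) :=
    ((summable_nat_add_iff 1).2 ht).hasSum
  have h₀ : HasSum (fun k => t k / r ^ k) (∑' k, t (k + 1) / r ^ (k + 1)) := by
    simpa [ht₀] using (hasSum_nat_add_iff (f := fun k => t k / r ^ k) 1).1 h₁
  have e : ∑' k, t (k + 1) / r ^ (k + 2) = (∑' k, t (k + 1) / r ^ (k + 1)) / r := by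
    rw [← tsum_div_const]
    exact tsum_congr fun k => by rw [pow_succ r (k + 1), div_mul_eq_div_div]
  have ef : (fun k => (t (k + 1) - t k) / r ^ (k + 1)) =
      fun k => t (k + 1) / r ^ (k + 1) - t k / r ^ k / r := by
    ext k
    rw [sub_div, pow_succ r k, div_mul_eq_div_div (t k)]
  have ev : (r - 1) * ∑' k, t (k + 1) / r ^ (k + 2) =
      ∑' k, t (k + 1) / r ^ (k + 1) - (∑' k, t (k + 1) / r ^ (k + 1)) / r := by
    rw [e]
    field_simp
  rw [ef, ev]
  exact h₁.sub (h₀.div_const r)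

theorem entropy_limit (m : ℕ) (hm : 1 ≤ m)
    (lam lam' : ℝ)
    (hlam : lam = (m + Real.sqrt (m ^ 2 + 4)) / 2)
    (hlam' : lam' = m - lam) :
    Filter.Tendsto
      (fun k : ℕ => Real.log (Nat.card (G m k)) / (ell m k : ℝ))
      Filter.atTop
      (nhds ((lam - 1) / (1 - lam') *
        ∑' i : ℕ, Real.log (m * ((i + 2) - 1) + 1) / lam ^ (i + 2))) := by
  have hm' : (1 : ℝ) ≤ m := by exact_mod_cast hm
  have hsq : Real.sqrt (m ^ 2 + 4) ^ 2 = (m : ℝ) ^ 2 + 4 := Real.sq_sqrt (by positivity)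
  have hlt : 1 < lam := by
    have : 1 < Real.sqrt ((m : ℝ) ^ 2 + 4) := Real.lt_sqrt_of_sq_lt (by nlinarith)
    linarith
  have hadd : lam + lam' = m := by linarith
  have hmul : lam * lam' = -1 := by
    rw [hlam', hlam]; linear_combination -hsq / 4
  have habs : |lam'| < 1 := by
    have h : |lam| * |lam'| = 1 := by rw [← abs_mul, hmul]; simp
    rw [abs_of_pos (by linarith)] at h
    nlinarith [abs_nonneg lam']
  have hlt' : lam' < 1 := (le_abs_self _).trans_lt habs
  set t : ℕ → ℝ := fun k => Real.log (m * k + 1) with ht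
  have ht₀ : t 0 = 0 := by simp [ht]
  have htn (k : ℕ) : 0 ≤ t k := Real.log_nonneg (by simp; positivity)
  have hts : Summable fun k => t k / lam ^ k := by
    have hg := (summable_pow_mul_geometric_of_norm_lt_one (R := ℝ) 1 (r := lam⁻¹) (by
      rw [Real.norm_of_nonneg (by positivity)]; exact inv_lt_one_of_one_lt₀ hlt)).mul_left (m : ℝ)
    refine Summable.of_nonneg_of_le (fun k => div_nonneg (htn k) (by positivity)) (fun k => ?_) hg
    have := Real.log_le_sub_one_of_pos (show (0 : ℝ) < m * k + 1 by positivity)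
    rw [pow_one, inv_pow, ← mul_assoc, ← div_eq_mul_inv]
    gcongr
    simpa [ht] using this
  have hts' (k : ℕ) : |t (k + 1) - t k| ≤ Real.log (m + 1) := by
    have h₁ : t k ≤ t (k + 1) :=
      Real.log_le_log (by positivity) (by push_cast; nlinarith)
    have h₂ : t (k + 1) ≤ Real.log ((m + 1) * (m * k + 1)) :=
      Real.log_le_log (by positivity) (by
        push_cast
        nlinarith [mul_nonneg (sq_nonneg (m : ℝ)) k.cast_nonneg])
    rw [Real.log_mul (by positivity) (by positivity)] at h₂
    rw [abs_of_nonneg (by linarith)]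
    linarith
  have hL := tendsto_div_pow_of_linear_recurrence
    (x := fun k => Real.log (substLanguage m k).card) hlt habs
    (fun k => by
      rw [hadd, hmul, log_card_substLanguage_add_two hm k]; ring)
    hts' (hasSum_sub_div_pow (by positivity) ht₀ hts)
  have hE := tendsto_div_pow_of_linear_recurrence (x := fun k => (ell m (k + 1) : ℝ))
    (s := 0) (K := 0) (c := 0) hlt habs
    (fun k => by
      rw [hadd, hmul]
      simp only [ell]
      push_cast
      simp)
    (fun k => by simp) (by simp)
  have hd : lam - lam' ≠ 0 := by linarith
  have hd' : 1 - lam' ≠ 0 := by linarith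
  rw [← tendsto_add_atTop_iff_nat 1]
  have h := hL.div hE (by simpa [ell] using ⟨hd', hd⟩)
  convert h using 1
  · ext k
    have : lam ^ k ≠ 0 := by positivity
    simp only [Pi.div_apply]
    rw [div_div_div_cancel_right₀ this]
    rfl
  · congr 1
    have h0 : (substLanguage m 0).card = 1 := Set.ncard_singleton _
    have h1 : (substLanguage m 1).card = 1 := Set.ncard_singleton _
    have e (i : ℕ) : Real.log (m * ((i + 2) - 1) + 1) = t (i + 1) := by
      simp only [ht]; push_cast; ring_nf
    simp only [h0, h1, e, ell, Nat.cast_one, Real.log_one, mul_zero, mul_one, sub_zero, zero_add,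
      add_zero]
    rw [div_div_div_cancel_right₀ hd, div_mul_eq_mul_div]
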